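/- Let $s\ge 0$, $1<p<\infty$, $d\ge1$, $k\ge1$, and $\phi\in\mathcal{S}(\mathbb{R}^d)$. Then $\|J^{s-1}\partial_1(\phi(x)e^{ikx_1})-\langle k\rangle^{s-1}(ik)\phi(x)e^{ikx_1}\|_{L^p}\le C(\phi,d,s,p)\,k^{s-1}$, where $J^{s-1}\partial_1$ is the Fourier multiplier with symbol $(1+|\xi|^2)^{(s-1)/2}(i\xi_1)$. -/

import Mathlib

open MeasureTheory
open scoped ENNReal RealInnerProductSpace

noncomputable abbrev Ed (d : ℕ) := EuclideanSpace ℝ (Fin d)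

/-- The Fourier transform in the convention `f̂(ξ) = ∫ f(x) e^{-i x·ξ} dx`. -/
noncomputable def pFT {d : ℕ} (f : Ed d → ℂ) (ξ : Ed d) : ℂ :=
  ∫ x : Ed d, Complex.exp (-(Complex.I) * ((⟪x, ξ⟫ : ℝ) : ℂ)) * f x

section Symbol

variable {E : Type*} [NormedAddCommGroup E] [InnerProductSpace ℝ E]

theorem norm_iteratedFDeriv_clm_le {F : Type*} [NormedAddCommGroup F] [NormedSpace ℝ F]
    (f : E →L[ℝ] F) {c : ℝ} (hf : ‖f‖ ≤ c) {x : E} {L : ℝ} (hL0 : 0 < L) (hL : ‖x‖ ≤ L) (i : ℕ) :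
    ‖iteratedFDeriv ℝ i f x‖ ≤ c * L * (1 / L) ^ i := by
  have hc : 0 ≤ c := (norm_nonneg f).trans hf
  have hfd : fderiv ℝ f = fun _ ↦ f := by ext1 v; simp only [ContinuousLinearMap.fderiv]
  match i with
  | 0 =>
    rw [norm_iteratedFDeriv_zero, pow_zero, mul_one]
    exact (f.le_of_opNorm_le hf x).trans (by gcongr)
  | 1 =>
    rw [← norm_iteratedFDeriv_fderiv, hfd, norm_iteratedFDeriv_zero, pow_one, mul_assoc,
      mul_one_div_cancel hL0.ne', mul_one]
    exact hf
  | (n + 2) =>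
    rw [← norm_iteratedFDeriv_fderiv, hfd, iteratedFDeriv_succ_const, Pi.zero_apply, norm_zero]
    positivity

theorem norm_iteratedFDeriv_norm_sq_le {x : E} {L : ℝ} (hL0 : 0 < L) (hL : ‖x‖ ≤ L) {i : ℕ}
    (hi : 1 ≤ i) : ‖iteratedFDeriv ℝ i (fun y : E => ‖y‖ ^ 2) x‖ ≤ L ^ 2 * (2 / L) ^ i := by
  obtain ⟨m, rfl⟩ := Nat.exists_eq_add_of_le' hi
  have hd : fderiv ℝ (fun y : E => ‖y‖ ^ 2) =
      ((2 : ℝ) • innerSL ℝ (E := E) : E →L[ℝ] E →L[ℝ] ℝ) := by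
    rw [fderiv_norm_sq]
    ext x y
    simp [two_mul]
  have hn : ‖((2 : ℝ) • innerSL ℝ (E := E) : E →L[ℝ] E →L[ℝ] ℝ)‖ ≤ 2 := by
    refine ContinuousLinearMap.opNorm_le_bound _ (by norm_num) fun v => ?_
    rw [smul_apply, norm_smul, Real.norm_two, innerSL_apply_norm]
  rw [← norm_iteratedFDeriv_fderiv, hd]
  calc _ ≤ 2 * L * (1 / L) ^ m := norm_iteratedFDeriv_clm_le _ hn hL0 hL m
    _ = L ^ 2 * (2 * (1 / L) ^ (m + 1)) := by
        rw [pow_succ (1 / L) m]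
        generalize (1 / L) ^ m = q
        field_simp
    _ ≤ L ^ 2 * (2 ^ (m + 1) * (1 / L) ^ (m + 1)) := by
        gcongr
        exact le_self_pow₀ (by norm_num) (by omega)
    _ = _ := by rw [← mul_pow, mul_one_div]

theorem contDiff_one_add_norm_sq_rpow (r : ℝ) :
    ContDiff ℝ ⊤ (fun y : E => (1 + ‖y‖ ^ 2) ^ r) := by
  refine ContDiff.rpow_const_of_ne (contDiff_const.add (contDiff_norm_sq ℝ)) fun y => by positivity

theorem exists_norm_iteratedFDeriv_bessel_le (r : ℝ) (n : ℕ) :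
    ∃ C : ℝ, 0 ≤ C ∧ ∀ (x : E),
      ‖iteratedFDeriv ℝ n (fun y : E => (1 + ‖y‖ ^ 2) ^ r) x‖ ≤
        C * (1 + ‖x‖ ^ 2) ^ r * (1 / √(1 + ‖x‖ ^ 2)) ^ n := by
  set A : ℝ := ∑ i ∈ Finset.range (n + 1),
    ‖iteratedFDerivWithin ℝ i (fun y : ℝ => y ^ r) (Set.Ioi 0) 1‖
  refine ⟨n.factorial * A * 2 ^ n, by positivity, fun x => ?_⟩
  have hpos : 0 < 1 + ‖x‖ ^ 2 := by positivity
  set L := √(1 + ‖x‖ ^ 2) with hLdef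
  have hL0 : 0 < L := by positivity
  have hL2 : L ^ 2 = 1 + ‖x‖ ^ 2 := Real.sq_sqrt hpos.le
  have hxL : ‖x‖ ≤ L := Real.le_sqrt_of_sq_le (by linarith)
  set f : E → ℝ := fun y => (L ^ 2)⁻¹ • (1 + ‖y‖ ^ 2) with hf
  have hfc : ContDiff ℝ ⊤ f := contDiff_const.fun_smul (contDiff_const.add (contDiff_norm_sq ℝ))
  have hfx : f x = 1 := by simp [hf, ← hL2, hL0.ne']
  have hw : (fun y : E => (1 + ‖y‖ ^ 2) ^ r) =
      fun y => (1 + ‖x‖ ^ 2) ^ r • ((fun y : ℝ => y ^ r) ∘ f) y := by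
    ext y
    simp only [hf, smul_eq_mul, Function.comp_apply, hL2]
    rw [← Real.mul_rpow (by positivity) (by positivity), mul_inv_cancel_left₀ hpos.ne']
  have hrange : Set.range f ⊆ Set.Ioi 0 := by
    rintro _ ⟨y, rfl⟩
    simp only [hf, smul_eq_mul, Set.mem_Ioi]
    positivity
  have hg : ContDiffOn ℝ ⊤ (fun y : ℝ => y ^ r) (Set.Ioi 0) :=
    contDiffOn_fun_id.rpow_const_of_ne fun y hy => (Set.mem_Ioi.1 hy).ne'
  have hgf : ContDiff ℝ ⊤ ((fun y : ℝ => y ^ r) ∘ f) :=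
    hfc.rpow_const_of_ne fun y => (hrange ⟨y, rfl⟩ : 0 < f y).ne'
  have key := norm_iteratedFDeriv_comp_le' (n := n) hrange isOpen_Ioi.uniqueDiffOn hg hfc
    (by exact_mod_cast le_top) x (C := A) (D := 2 / L) ?_ ?_
  · rw [hw, iteratedFDeriv_const_smul_apply' (hgf.of_le (by exact_mod_cast le_top)).contDiffAt,
      norm_smul, Real.norm_of_nonneg (by positivity)]
    calc _ ≤ (1 + ‖x‖ ^ 2) ^ r * (n.factorial * A * (2 / L) ^ n) := by gcongr
      _ = _ := by rw [div_pow, div_pow]; ring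
  · intro i hi
    rw [hfx]
    exact Finset.single_le_sum
      (f := fun i => ‖iteratedFDerivWithin ℝ i (fun y : ℝ => y ^ r) (Set.Ioi 0) 1‖)
      (fun _ _ => norm_nonneg _) (Finset.mem_range_succ_iff.2 hi)
  · intro i hi _
    have h1 : ContDiff ℝ i (fun y : E => ‖y‖ ^ 2) := contDiff_norm_sq ℝ
    have h2 : iteratedFDeriv ℝ i f x = (L ^ 2)⁻¹ • iteratedFDeriv ℝ i (fun y : E => ‖y‖ ^ 2) x := by
      rw [hf, iteratedFDeriv_const_smul_apply' (contDiff_const.add h1).contDiffAt,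
        fun_iteratedFDeriv_add_apply contDiff_const.contDiffAt h1.contDiffAt,
        iteratedFDeriv_const_of_ne (by omega)]
      simp
    rw [h2, norm_smul, Real.norm_of_nonneg (by positivity)]
    calc _ ≤ (L ^ 2)⁻¹ * (L ^ 2 * (2 / L) ^ i) := by
          gcongr; exact norm_iteratedFDeriv_norm_sq_le hL0 hxL hi
      _ = _ := inv_mul_cancel_left₀ (by positivity) _

/-- The symbol `⟨ξ⟩^{2r} ξ_f`. -/
noncomputable def besselDeriv (f : E →L[ℝ] ℝ) (r : ℝ) (x : E) : ℝ := f x * (1 + ‖x‖ ^ 2) ^ r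

theorem contDiff_besselDeriv (f : E →L[ℝ] ℝ) (r : ℝ) : ContDiff ℝ ⊤ (besselDeriv f r) :=
  f.contDiff.mul (contDiff_one_add_norm_sq_rpow r)

theorem exists_norm_iteratedFDeriv_besselDeriv_le (f : E →L[ℝ] ℝ) (hf : ‖f‖ ≤ 1) (r : ℝ) {n : ℕ}
    (hn : 1 ≤ n) :
    ∃ C : ℝ, 0 ≤ C ∧ ∀ x : E,
      ‖iteratedFDeriv ℝ n (besselDeriv f r) x‖ ≤ C * (1 + ‖x‖ ^ 2) ^ r := by
  choose C hC0 hC using exists_norm_iteratedFDeriv_bessel_le (E := E) r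
  refine ⟨∑ i ∈ Finset.range (n + 1), n.choose i * C (n - i),
    Finset.sum_nonneg fun i _ => mul_nonneg (by positivity) (hC0 _), fun x => ?_⟩
  have hpos : 0 < 1 + ‖x‖ ^ 2 := by positivity
  set L := √(1 + ‖x‖ ^ 2) with hLdef
  have hL0 : 0 < L := by positivity
  have hL1 : 1 ≤ L := Real.one_le_sqrt.2 (by linarith [sq_nonneg ‖x‖])
  have hxL : ‖x‖ ≤ L := Real.le_sqrt_of_sq_le (by linarith)
  refine (norm_iteratedFDeriv_mul_le (N := ⊤) f.contDiff (contDiff_one_add_norm_sq_rpow r) x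
    (by exact_mod_cast le_top)).trans ?_
  rw [Finset.sum_mul]
  refine Finset.sum_le_sum fun i hi => ?_
  have hi' : i ≤ n := Finset.mem_range_succ_iff.1 hi
  have hCi := hC0 (n - i)
  calc _ ≤ n.choose i * (L * (1 / L) ^ i) *
        (C (n - i) * (1 + ‖x‖ ^ 2) ^ r * (1 / L) ^ (n - i)) := by
        gcongr
        · simpa using norm_iteratedFDeriv_clm_le f hf hL0 hxL i
        · exact hC (n - i) x
    _ = n.choose i * C (n - i) * (1 + ‖x‖ ^ 2) ^ r * (L * (1 / L) ^ n) := by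
        rw [← Nat.add_sub_cancel' hi', pow_add]
        simp only [Nat.add_sub_cancel_left]
        ring
    _ ≤ n.choose i * C (n - i) * (1 + ‖x‖ ^ 2) ^ r * 1 := by
        gcongr
        obtain ⟨m, rfl⟩ := Nat.exists_eq_add_of_le' hn
        rw [pow_succ', ← mul_assoc, mul_one_div_cancel hL0.ne', one_mul]
        exact pow_le_one₀ (by positivity) ((div_le_one hL0).2 hL1)
    _ = _ := by ring

end Symbol

theorem one_add_norm_add_sq_rpow_le {E : Type*} [SeminormedAddCommGroup E] (x y : E) (r : ℝ) :
    (1 + ‖x + y‖ ^ 2) ^ r ≤ 2 ^ |r| * (1 + ‖x‖ ^ 2) ^ |r| * (1 + ‖y‖ ^ 2) ^ r := by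
  have key (u v : E) : 1 + ‖u + v‖ ^ 2 ≤ 2 * (1 + ‖u‖ ^ 2) * (1 + ‖v‖ ^ 2) := by
    have h := norm_add_le u v
    have h2 : ‖u + v‖ ^ 2 ≤ (‖u‖ + ‖v‖) ^ 2 := by gcongr
    nlinarith [sq_nonneg (‖u‖ - ‖v‖), sq_nonneg (‖u‖ * ‖v‖)]
  rcases le_total 0 r with hr | hr
  · rw [abs_of_nonneg hr, ← Real.mul_rpow (by positivity) (by positivity),
      ← Real.mul_rpow (by positivity) (by positivity)]
    exact Real.rpow_le_rpow (by positivity) (key x y) hr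
  · have h := key (-x) (x + y)
    rw [neg_add_cancel_left, norm_neg] at h
    have h' := Real.rpow_le_rpow (by positivity) h (abs_nonneg r)
    rw [Real.mul_rpow (by positivity) (by positivity),
      Real.mul_rpow (by positivity) (by positivity)] at h'
    have hr' : r = -|r| := by rw [abs_of_nonpos hr, neg_neg]
    have e (u : E) : (1 + ‖u‖ ^ 2) ^ r = ((1 + ‖u‖ ^ 2) ^ |r|)⁻¹ := by
      conv_lhs => rw [hr']
      exact Real.rpow_neg (by positivity) _
    rw [e, e, ← div_eq_mul_inv, le_div_iff₀ (by positivity), ← div_eq_inv_mul,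
      div_le_iff₀ (by positivity)]
    exact h'

theorem one_add_norm_sq_rpow_le {E : Type*} [SeminormedAddCommGroup E] (x : E) (r : ℝ) :
    (1 + ‖x‖ ^ 2) ^ |r| ≤ (1 + ‖x‖) ^ ⌈2 * |r|⌉₊ := by
  calc (1 + ‖x‖ ^ 2) ^ |r| ≤ ((1 + ‖x‖) ^ 2) ^ |r| := by
        gcongr
        nlinarith [norm_nonneg x]
    _ = (1 + ‖x‖) ^ (2 * |r|) := by
        rw [Real.rpow_mul (by positivity), Real.rpow_two]
    _ ≤ (1 + ‖x‖) ^ ((⌈2 * |r|⌉₊ : ℕ) : ℝ) :=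
        Real.rpow_le_rpow_of_exponent_le (by linarith [norm_nonneg x]) (Nat.le_ceil _)
    _ = _ := Real.rpow_natCast _ _

section Shift

variable {E : Type*} [NormedAddCommGroup E] [InnerProductSpace ℝ E]

theorem exists_norm_iteratedFDeriv_besselDeriv_shift_le (f : E →L[ℝ] ℝ) (hf : ‖f‖ ≤ 1) (r : ℝ)
    (n : ℕ) :
    ∃ C : ℝ, 0 ≤ C ∧ ∀ e x : E,
      ‖iteratedFDeriv ℝ n (fun y => besselDeriv f r (y + e) - besselDeriv f r e) x‖ ≤
        C * (1 + ‖e‖ ^ 2) ^ r * (1 + ‖x‖) ^ (⌈2 * |r|⌉₊ + 1) := by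
  have shift {C : ℝ} (hC0 : 0 ≤ C) (e z : E) : C * (1 + ‖z + e‖ ^ 2) ^ r ≤
      C * 2 ^ |r| * (1 + ‖e‖ ^ 2) ^ r * (1 + ‖z‖) ^ ⌈2 * |r|⌉₊ := by
    calc _ ≤ C * (2 ^ |r| * (1 + ‖z‖ ^ 2) ^ |r| * (1 + ‖e‖ ^ 2) ^ r) := by
          gcongr
          exact one_add_norm_add_sq_rpow_le z e r
      _ ≤ C * (2 ^ |r| * (1 + ‖z‖) ^ ⌈2 * |r|⌉₊ * (1 + ‖e‖ ^ 2) ^ r) := by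
          gcongr
          exact one_add_norm_sq_rpow_le z r
      _ = _ := by ring
  have hM := contDiff_besselDeriv f r
  rcases Nat.eq_zero_or_pos n with rfl | hn
  · obtain ⟨C, hC0, hC⟩ := exists_norm_iteratedFDeriv_besselDeriv_le f hf r le_rfl
    refine ⟨C * 2 ^ |r|, by positivity, fun e x => ?_⟩
    rw [norm_iteratedFDeriv_zero]
    have := (convex_closedBall e ‖x‖).norm_image_sub_le_of_norm_fderiv_le (𝕜 := ℝ)
      (f := besselDeriv f r) (C := C * 2 ^ |r| * (1 + ‖e‖ ^ 2) ^ r * (1 + ‖x‖) ^ ⌈2 * |r|⌉₊)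
      (x := e) (y := x + e) (fun z _ => (hM.differentiable (by simp)).differentiableAt)
      (fun z hz => ?_) (by simp) (by simp)
    · refine this.trans ?_
      rw [add_sub_cancel_right, pow_succ (1 + ‖x‖), ← mul_assoc]
      gcongr
      linarith
    · have h1 := hC z
      rw [← zero_add 1, ← norm_iteratedFDeriv_fderiv, norm_iteratedFDeriv_zero] at h1
      have h2 := shift hC0 e (z - e)
      rw [sub_add_cancel] at h2
      have h3 : ‖z - e‖ ≤ ‖x‖ := by simpa [dist_eq_norm] using hz
      refine (h1.trans h2).trans ?_
      gcongr
  · obtain ⟨C, hC0, hC⟩ := exists_norm_iteratedFDeriv_besselDeriv_le f hf r hn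
    refine ⟨C * 2 ^ |r|, by positivity, fun e x => ?_⟩
    have hsub : ContDiff ℝ n (fun y => besselDeriv f r (y + e)) :=
      (hM.of_le (by exact_mod_cast le_top)).comp (contDiff_id.add contDiff_const)
    rw [fun_iteratedFDeriv_sub_apply hsub.contDiffAt contDiff_const.contDiffAt,
      iteratedFDeriv_const_of_ne hn.ne', Pi.zero_apply, sub_zero, iteratedFDeriv_comp_add_right]
    refine ((hC _).trans (shift hC0 e x)).trans ?_
    gcongr
    · linarith [norm_nonneg x]
    · omega

theorem exists_norm_iteratedFDeriv_besselDeriv_dilate_le (f : E →L[ℝ] ℝ) (hf : ‖f‖ ≤ 1) (r : ℝ)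
    {t : ℝ} (ht : 1 ≤ t) (n : ℕ) :
    ∃ C : ℝ, 0 ≤ C ∧ ∀ e x : E,
      ‖iteratedFDeriv ℝ n (fun y => besselDeriv f r (t • y + e) - besselDeriv f r e) x‖ ≤
        C * (1 + ‖e‖ ^ 2) ^ r * (1 + ‖x‖) ^ (⌈2 * |r|⌉₊ + 1) := by
  obtain ⟨C, hC0, hC⟩ := exists_norm_iteratedFDeriv_besselDeriv_shift_le f hf r n
  refine ⟨t ^ n * C * t ^ (⌈2 * |r|⌉₊ + 1), by positivity, fun e x => ?_⟩
  have hsub : ContDiff ℝ n (fun y => besselDeriv f r (y + e) - besselDeriv f r e) :=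
    (((contDiff_besselDeriv f r).of_le (by exact_mod_cast le_top)).comp
      (contDiff_id.add contDiff_const)).sub contDiff_const
  rw [iteratedFDeriv_comp_const_smul t hsub, norm_smul, Real.norm_of_nonneg (by positivity)]
  calc _ ≤ t ^ n * (C * (1 + ‖e‖ ^ 2) ^ r * (1 + ‖t • x‖) ^ (⌈2 * |r|⌉₊ + 1)) := by
        gcongr
        exact hC e (t • x)
    _ ≤ t ^ n * (C * (1 + ‖e‖ ^ 2) ^ r * (t * (1 + ‖x‖)) ^ (⌈2 * |r|⌉₊ + 1)) := by
        gcongr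
        rw [norm_smul, Real.norm_of_nonneg (by positivity)]
        linarith
    _ = _ := by
        rw [mul_pow]
        ring

end Shift

theorem SchwartzMap.exists_seminorm_le_of_eq_smul {E F : Type*} [NormedAddCommGroup E]
    [NormedSpace ℝ E] [NormedAddCommGroup F] [NormedSpace ℝ F] (φ : SchwartzMap E F) {A : ℕ → ℝ}
    (hA : ∀ n, 0 ≤ A n) (N a n : ℕ) :
    ∃ C : ℝ, 0 ≤ C ∧ ∀ K : ℝ, 0 ≤ K → ∀ b : E → ℝ, ContDiff ℝ ⊤ b →
      (∀ j x, ‖iteratedFDeriv ℝ j b x‖ ≤ A j * K * (1 + ‖x‖) ^ N) →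
      ∀ ψ : SchwartzMap E F, (∀ x, ψ x = b x • φ x) → SchwartzMap.seminorm ℝ a n ψ ≤ C * K := by
  set S := 2 ^ (a + N) * (Finset.Iic (a + N, n)).sup (fun m => SchwartzMap.seminorm ℝ m.1 m.2) φ
  have hS : 0 ≤ S := mul_nonneg (by positivity) (apply_nonneg _ _)
  have hC : 0 ≤ ∑ i ∈ Finset.range (n + 1), n.choose i * A i * S :=
    Finset.sum_nonneg fun i _ => mul_nonneg (mul_nonneg (by positivity) (hA i)) hS
  refine ⟨∑ i ∈ Finset.range (n + 1), n.choose i * A i * S, hC, fun K hK b hb hbA ψ hψ => ?_⟩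
  refine SchwartzMap.seminorm_le_bound ℝ a n ψ (by positivity) fun x => ?_
  have hψ' : (ψ : E → F) = fun y => b y • φ y := funext hψ
  rw [hψ']
  refine (mul_le_mul_of_nonneg_left (norm_iteratedFDeriv_smul_le (N := n)
    (hb.of_le (by exact_mod_cast le_top)) (φ.smooth n) x le_rfl) (by positivity)).trans ?_
  rw [Finset.mul_sum, Finset.sum_mul]
  refine Finset.sum_le_sum fun i hi => ?_
  have hAi := hA i
  calc _ ≤ (1 + ‖x‖) ^ a * (n.choose i * (A i * K * (1 + ‖x‖) ^ N) *
        ‖iteratedFDeriv ℝ (n - i) φ x‖) := by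
        gcongr
        · linarith
        · exact hbA i x
    _ = n.choose i * A i * ((1 + ‖x‖) ^ (a + N) * ‖iteratedFDeriv ℝ (n - i) φ x‖) * K := by ring
    _ ≤ _ := by
        gcongr
        exact SchwartzMap.one_add_le_sup_seminorm_apply (m := (a + N, n)) le_rfl
          (Nat.sub_le _ _) φ x

theorem hasTemperateGrowth_cexp_neg_I_mul :
    (fun t : ℝ => Complex.exp (-Complex.I * (t : ℂ))).HasTemperateGrowth := by
  have hd (n : ℕ) : iteratedDeriv n (fun t : ℝ => Complex.exp (-Complex.I * (t : ℂ))) =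
      fun t : ℝ => (-Complex.I) ^ n * Complex.exp (-Complex.I * (t : ℂ)) := by
    induction n with
    | zero => simp
    | succ n ih =>
      rw [iteratedDeriv_succ, ih]
      ext t
      have h : HasDerivAt (fun t : ℝ => (-Complex.I) ^ n * Complex.exp (-Complex.I * (t : ℂ))) _ t :=
        (((hasDerivAt_id t).ofReal_comp.const_mul (-Complex.I)).cexp).const_mul _
      rw [h.deriv]
      simp only [id, Complex.ofReal_one]
      ring
  refine ⟨(contDiff_const.mul Complex.ofRealCLM.contDiff).cexp, fun n => ⟨0, 1, fun t => ?_⟩⟩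
  rw [norm_iteratedFDeriv_eq_norm_iteratedDeriv, hd]
  simp [Complex.norm_exp]

open scoped FourierTransform

theorem SchwartzMap.exists_eLpNorm_le_seminorm_fourier {V : Type*} [NormedAddCommGroup V]
    [InnerProductSpace ℝ V] [FiniteDimensional ℝ V] [MeasurableSpace V] [BorelSpace V]
    (p : ℝ≥0∞) (hp : 1 ≤ p) :
    ∃ (s : Finset (ℕ × ℕ)) (C : ℝ), 0 ≤ C ∧ ∀ f : SchwartzMap V ℂ,
      eLpNorm f p volume ≤
        ENNReal.ofReal (C * s.sup (schwartzSeminormFamily ℝ V ℂ) (𝓕 f : SchwartzMap V ℂ)) := by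
  have : Fact (1 ≤ p) := ⟨hp⟩
  let T : SchwartzMap V ℂ →L[ℝ] Lp ℂ p (volume : Measure V) :=
    (SchwartzMap.toLpCLM ℝ ℂ p volume).comp (FourierTransform.fourierInvCLM ℝ (SchwartzMap V ℂ))
  obtain ⟨s, C, -, hC⟩ := Seminorm.bound_of_continuous (schwartz_withSeminorms ℝ V ℂ)
    ((normSeminorm ℝ (Lp ℂ p (volume : Measure V))).comp T.toLinearMap)
    (continuous_norm.comp T.continuous)
  refine ⟨s, C, C.coe_nonneg, fun f => ?_⟩
  have h : ‖f.toLp p volume‖ ≤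
      C * s.sup (schwartzSeminormFamily ℝ V ℂ) (𝓕 f : SchwartzMap V ℂ) := by
    have h1 := hC (𝓕 f)
    have h2 : T (𝓕 f) = f.toLp p volume := by
      simp [T]
    simpa [h2] using! h1
  rw [SchwartzMap.norm_toLp] at h
  exact (ENNReal.le_ofReal_iff_toReal_le (f.memLp p volume).eLpNorm_ne_top
    (mul_nonneg C.coe_nonneg (apply_nonneg _ _))).2 h

theorem fourier_eq_pFT {d : ℕ} (f : Ed d → ℂ) (ξ : Ed d) : 𝓕 f ξ = pFT f ((2 * Real.pi) • ξ) := by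
  rw [Real.fourier_eq', pFT]
  refine integral_congr_ae (.of_forall fun x => ?_)
  simp only [smul_eq_mul, inner_smul_right]
  congr 2
  push_cast
  ring

theorem pFT_modulate {d : ℕ} (f : Ed d → ℂ) (k : ℝ) (i : Fin d) (ξ : Ed d) :
    pFT (fun x => Complex.exp (-Complex.I * ((k * x i : ℝ) : ℂ)) * f x) ξ =
      pFT f (ξ + EuclideanSpace.single i k) := by
  refine integral_congr_ae (.of_forall fun x => ?_)
  simp only [inner_add_right, EuclideanSpace.inner_single_right]
  rw [← mul_assoc, ← Complex.exp_add]
  congr 2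
  simp
  ring

theorem one_add_sq_rpow_le {k : ℝ} (hk : 1 ≤ k) (r : ℝ) :
    (1 + k ^ 2) ^ r ≤ 2 ^ |r| * k ^ (2 * r) := by
  have hk0 : 0 < k := by linarith
  rw [Real.rpow_mul hk0.le, Real.rpow_two]
  rcases le_total 0 r with hr | hr
  · rw [abs_of_nonneg hr, ← Real.mul_rpow (by positivity) (by positivity)]
    exact Real.rpow_le_rpow (by positivity) (by nlinarith) hr
  · calc (1 + k ^ 2) ^ r ≤ (k ^ 2) ^ r :=
          Real.rpow_le_rpow_of_nonpos (by positivity) (by linarith) hr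
      _ ≤ _ := le_mul_of_one_le_left (by positivity)
          (Real.one_le_rpow (by norm_num) (abs_nonneg r))

/-- `‖J^{s-1}∂₁(φ e^{ikx₁}) - ⟨k⟩^{s-1}(ik) φ e^{ikx₁}‖_p ≤ C k^{s-1}`
for `k ≥ 1`, where `J^{s-1}∂₁` is the Fourier multiplier with symbol
`(1+|ξ|²)^{(s-1)/2} (iξ₁)` and `⟨k⟩ = (1+k²)^{1/2}`. -/
theorem stmt15 {d : ℕ} (hd : 0 < d) (s p : ℝ) (hs : 0 ≤ s) (hp1 : 1 < p)
    (φ : SchwartzMap (Ed d) ℂ) :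
    ∃ C : ℝ, 0 ≤ C ∧ ∀ k : ℝ, 1 ≤ k → ∀ G : SchwartzMap (Ed d) ℂ,
      (∀ ξ : Ed d, pFT (⇑G) ξ =
        (((1 + ‖ξ‖ ^ 2) ^ ((s - 1) / 2) : ℝ) : ℂ) * (Complex.I * ((ξ ⟨0, hd⟩ : ℝ) : ℂ)) *
          pFT (fun x => φ x * Complex.exp (Complex.I * ((k * x ⟨0, hd⟩ : ℝ) : ℂ))) ξ) →
      eLpNorm (fun x : Ed d =>
          G x - (((1 + k ^ 2) ^ ((s - 1) / 2) : ℝ) : ℂ) * (Complex.I * (k : ℂ)) * φ x *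
            Complex.exp (Complex.I * ((k * x ⟨0, hd⟩ : ℝ) : ℂ)))
        (ENNReal.ofReal p) volume ≤ ENNReal.ofReal (C * k ^ (s - 1)) := by
  set r := (s - 1) / 2 with hr
  have hsr : s - 1 = 2 * r := by rw [hr]; ring
  set i₀ : Fin d := ⟨0, hd⟩
  let f : Ed d →L[ℝ] ℝ := EuclideanSpace.proj i₀
  have hf : ‖f‖ ≤ 1 := ContinuousLinearMap.opNorm_le_bound _ zero_le_one fun x => by
    simpa [f] using PiLp.norm_apply_le x i₀
  choose A hA0 hA using fun n =>
    exists_norm_iteratedFDeriv_besselDeriv_dilate_le f hf r (t := 2 * Real.pi)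
      (by linarith [Real.two_le_pi]) n
  choose B hB0 hB using fun m : ℕ × ℕ =>
    SchwartzMap.exists_seminorm_le_of_eq_smul (Complex.I • (𝓕 φ : SchwartzMap (Ed d) ℂ)) hA0
      (⌈2 * |r|⌉₊ + 1) m.1 m.2
  obtain ⟨S, D, hD0, hD⟩ := SchwartzMap.exists_eLpNorm_le_seminorm_fourier (V := Ed d)
    (ENNReal.ofReal p) (ENNReal.one_le_ofReal.2 hp1.le)
  have hBS : 0 ≤ ∑ m ∈ S, B m := Finset.sum_nonneg fun m _ => hB0 m
  refine ⟨D * ((∑ m ∈ S, B m) * 2 ^ |r|), by positivity, fun k hk G hG => ?_⟩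
  have hk0 : 0 < k := by linarith
  set e : Ed d := EuclideanSpace.single i₀ k
  have he : ‖e‖ ^ 2 = k ^ 2 := by simp [e]
  have hfe : f e = k := by simp [f, e]
  set w : Ed d → ℂ := fun x => Complex.exp (-Complex.I * ((k * x i₀ : ℝ) : ℂ)) with hw
  have hwt : w.HasTemperateGrowth :=
    hasTemperateGrowth_cexp_neg_I_mul.comp (k • f).hasTemperateGrowth
  have hwn (x : Ed d) : ‖w x‖ = 1 := by simp [hw, Complex.norm_exp]
  have hwinv (x : Ed d) : w x * Complex.exp (Complex.I * ((k * x i₀ : ℝ) : ℂ)) = 1 := by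
    rw [hw, ← Complex.exp_add]
    simp
  set c : ℂ := (((1 + k ^ 2) ^ r : ℝ) : ℂ) * (Complex.I * (k : ℂ)) with hc
  set H : SchwartzMap (Ed d) ℂ := SchwartzMap.smulLeftCLM ℂ w G - c • φ with hH
  have hHx (x : Ed d) : H x = w x * G x - c * φ x := by
    simp [hH, SchwartzMap.smulLeftCLM_apply_apply hwt]
  have hnorm : eLpNorm (fun x : Ed d =>
      G x - c * φ x * Complex.exp (Complex.I * ((k * x i₀ : ℝ) : ℂ))) (ENNReal.ofReal p) volume =
      eLpNorm H (ENNReal.ofReal p) volume := by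
    refine eLpNorm_congr_norm_ae (.of_forall fun x => ?_)
    rw [← one_mul ‖G x - _‖, ← hwn x, ← norm_mul, hHx, mul_sub,
      mul_left_comm (w x), hwinv, mul_one]
  have hφ (ξ : Ed d) :
      pFT (fun x => φ x * Complex.exp (Complex.I * ((k * x i₀ : ℝ) : ℂ))) (ξ + e) = pFT φ ξ := by
    rw [← pFT_modulate]
    congr 1
    ext x
    rw [mul_left_comm]
    exact (congrArg (φ x * ·) (hwinv x)).trans (mul_one _)
  have hψ (ξ : Ed d) : (𝓕 H : SchwartzMap (Ed d) ℂ) ξ =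
      (besselDeriv f r ((2 * Real.pi) • ξ + e) - besselDeriv f r e) •
        (Complex.I • (𝓕 φ : SchwartzMap (Ed d) ℂ)) ξ := by
    have h1 : (𝓕 H : SchwartzMap (Ed d) ℂ) =
        𝓕 (SchwartzMap.smulLeftCLM ℂ w G) - c • 𝓕 φ := by
      simp only [hH, ← FourierTransform.fourierCLM_apply (R := ℂ), map_sub, map_smul]
    have h2 : (𝓕 (SchwartzMap.smulLeftCLM ℂ w G) : SchwartzMap (Ed d) ℂ) ξ =
        pFT G ((2 * Real.pi) • ξ + e) := by
      rw [SchwartzMap.fourier_coe, fourier_eq_pFT, ← pFT_modulate]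
      congr 1
      ext x
      exact SchwartzMap.smulLeftCLM_apply_apply hwt G x
    rw [h1, sub_apply, smul_apply, smul_apply, h2, hG, hφ, SchwartzMap.fourier_coe, fourier_eq_pFT]
    simp only [besselDeriv, hfe, he, hc, smul_eq_mul, Complex.real_smul]
    have : f ((2 * Real.pi) • ξ + e) = ((2 * Real.pi) • ξ + e) i₀ := rfl
    rw [this]
    push_cast
    ring
  set K := (1 + ‖e‖ ^ 2) ^ r with hK
  have hbound : S.sup (schwartzSeminormFamily ℝ (Ed d) ℂ) (𝓕 H : SchwartzMap (Ed d) ℂ) ≤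
      (∑ m ∈ S, B m) * K := by
    refine Seminorm.finset_sup_apply_le (by positivity) fun m hm => ?_
    refine (hB m K (by positivity) _ ?_ (fun j x => hA j e x) _ hψ).trans ?_
    · exact ((contDiff_besselDeriv f r).comp
        ((contDiff_id.const_smul _).add contDiff_const)).sub contDiff_const
    · gcongr
      exact Finset.single_le_sum (fun m _ => hB0 m) hm
  rw [hnorm, hsr]
  refine (hD H).trans (ENNReal.ofReal_le_ofReal ?_)
  calc _ ≤ D * ((∑ m ∈ S, B m) * K) := by gcongr
    _ ≤ D * ((∑ m ∈ S, B m) * (2 ^ |r| * k ^ (2 * r))) := by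
        gcongr
        rw [hK, he]
        exact one_add_sq_rpow_le hk r
    _ = _ := by ring
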